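/- arXiv:1801.06078 — 2 statements merged into one kernel-verified Lean document; each statement's English description precedes it below -/
import Mathlib

section
/- Let (W,S) be a finite Coxeter system and c a standard Coxeter element. If s ∈ S is a left or right descent of c, then scs is again a standard Coxeter element. -/
namespace NCpaper

open CoxeterSystem

variable {B : Type*} {W : Type*} [Group W] {M : CoxeterMatrix B}

/-- The absolute length: minimal length of a factorization into reflections. -/
noncomputable def absLength (cs : CoxeterSystem M W) (w : W) : ℕ :=
  sInf {k | ∃ l : List W, (∀ t ∈ l, cs.IsReflection t) ∧ l.length = k ∧ l.prod = w}

/-- The absolute order: `v ≤ w` iff `ℓ_T w = ℓ_T (v⁻¹ w) + ℓ_T v`. -/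
noncomputable def AbsLe (cs : CoxeterSystem M W) (v w : W) : Prop :=
  absLength cs w = absLength cs (v⁻¹ * w) + absLength cs v

/-- Cover relation of the absolute order. -/
noncomputable def AbsCovBy (cs : CoxeterSystem M W) (v w : W) : Prop :=
  cs.IsReflection (v⁻¹ * w) ∧ absLength cs w = absLength cs v + 1

/-- Generating relation of the Bruhat order: multiply by a reflection, length goes up. -/
def BruhatGen (cs : CoxeterSystem M W) (v w : W) : Prop :=
  cs.IsReflection (v⁻¹ * w) ∧ cs.length v < cs.length w

/-- The Bruhat order. -/
def BruhatLe (cs : CoxeterSystem M W) : W → W → Prop := Relation.ReflTransGen (BruhatGen cs)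

/-- The strict Bruhat order. -/
def BruhatLt (cs : CoxeterSystem M W) : W → W → Prop := Relation.TransGen (BruhatGen cs)

/-- The support of an element: simple reflections occurring in every (equivalently, some)
reduced word for it. -/
def supp (cs : CoxeterSystem M W) (w : W) : Set B :=
  {i | ∀ l : List B, cs.IsReduced l → cs.wordProd l = w → i ∈ l}

/-- A standard Coxeter element: the product of all the simple reflections, each once,
in some order. -/
def IsStdCoxeterElement (cs : CoxeterSystem M W) (c : W) : Prop :=
  ∃ l : List B, l.Nodup ∧ (∀ i : B, i ∈ l) ∧ cs.wordProd l = c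

/-- Generating relation for the order `⊏`: an absolute-order cover which is Bruhat-increasing. -/
noncomputable def SqGen (cs : CoxeterSystem M W) (v w : W) : Prop :=
  AbsCovBy cs v w ∧ BruhatLt cs v w

/-- The order `⊏`. -/
noncomputable def Sq (cs : CoxeterSystem M W) : W → W → Prop :=
  Relation.ReflTransGen (SqGen cs)

/-- Generating relation for the order `≪`: an absolute-order cover which is Bruhat-decreasing. -/
noncomputable def LlGen (cs : CoxeterSystem M W) (v w : W) : Prop :=
  AbsCovBy cs v w ∧ BruhatLt cs w v

/-- The order `≪`. -/
noncomputable def Ll (cs : CoxeterSystem M W) : W → W → Prop :=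
  Relation.ReflTransGen (LlGen cs)


open Classical in
/-- The signed permutation attached to a simple reflection. -/
noncomputable def sgn (cs : CoxeterSystem M W) (i : B) (p : W × ZMod 2) : W × ZMod 2 :=
  (cs.simple i * p.1 * cs.simple i, p.2 + if p.1 = cs.simple i then 1 else 0)

open Classical in
lemma sgn_pow (cs : CoxeterSystem M W) (i j : B) (n : ℕ) (t : W) (e : ZMod 2) :
    ((fun p => sgn cs i (sgn cs j p))^[n]) (t, e) =
      ((cs.simple i * cs.simple j) ^ n * t * ((cs.simple i * cs.simple j) ^ n)⁻¹,
        e + ∑ k ∈ Finset.range (2 * n),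
          if t = cs.simple j * (cs.simple i * cs.simple j) ^ k then 1 else 0) := by
  induction n with
  | zero => simp
  | succ n ih =>
    have hx : ∀ k : ℕ, cs.simple j * (cs.simple i * cs.simple j) ^ k
        = ((cs.simple i * cs.simple j) ^ k)⁻¹ * cs.simple j := by
      intro k
      induction k with
      | zero => simp
      | succ k ihk =>
        rw [pow_succ, ← mul_assoc, ihk, mul_inv_rev]
        have hc : cs.simple j * (cs.simple i * cs.simple j)
          = (cs.simple i * cs.simple j)⁻¹ * cs.simple j := by simp [mul_assoc]
        have hc2 : ((cs.simple i * cs.simple j) ^ k)⁻¹ * (cs.simple i * cs.simple j)⁻¹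
          = (cs.simple i * cs.simple j)⁻¹ * ((cs.simple i * cs.simple j) ^ k)⁻¹ := by
          rw [← mul_inv_rev, ← mul_inv_rev, ← pow_succ, ← pow_succ']
        rw [mul_assoc, hc, ← mul_assoc, hc2]
    have e1 : (cs.simple i * cs.simple j) ^ n * t * ((cs.simple i * cs.simple j) ^ n)⁻¹
        = cs.simple j ↔ t = cs.simple j * (cs.simple i * cs.simple j) ^ (2 * n) := by
      rw [two_mul, pow_add, ← mul_assoc, hx, mul_inv_eq_iff_eq_mul, mul_assoc, eq_inv_mul_iff_mul_eq]
    have e2 : cs.simple j * ((cs.simple i * cs.simple j) ^ n * t *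
          ((cs.simple i * cs.simple j) ^ n)⁻¹) * cs.simple j
        = cs.simple i ↔ t = cs.simple j * (cs.simple i * cs.simple j) ^ (2 * n + 1) := by
      rw [show 2 * n + 1 = n + (1 + n) by ring, pow_add,
        ← mul_assoc (cs.simple j) ((cs.simple i * cs.simple j) ^ n) (_ ^ (1 + n)), hx,
        pow_add, pow_one]
      constructor
      · intro h
        have h2 : (cs.simple i * cs.simple j) ^ n * t * ((cs.simple i * cs.simple j) ^ n)⁻¹
            = cs.simple j * cs.simple i * cs.simple j := by
          have h3 := congrArg (fun x => cs.simple j * x * cs.simple j) h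
          simpa [mul_assoc] using h3
        rw [mul_inv_eq_iff_eq_mul] at h2
        rw [mul_assoc, eq_inv_mul_iff_mul_eq, h2]
        simp [mul_assoc]
      · intro h
        rw [h]
        simp [mul_assoc]
    rw [Function.iterate_succ_apply', ih, show 2 * (n + 1) = 2 * n + 1 + 1 by ring,
      Finset.sum_range_succ, Finset.sum_range_succ]
    simp only [sgn, e1, e2]
    refine Prod.ext ?_ ?_
    · simp [pow_succ', mul_assoc]
    · simp [add_assoc]

lemma sgn_invol (cs : CoxeterSystem M W) (i : B) (p : W × ZMod 2) :
    sgn cs i (sgn cs i p) = p := by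
  classical
  obtain ⟨t, e⟩ := p
  have h : cs.simple i * t * cs.simple i = cs.simple i ↔ t = cs.simple i := by
    rw [mul_assoc, mul_eq_left, mul_eq_one_iff_eq_inv, cs.inv_simple]
  simp only [sgn, h]
  refine Prod.ext ?_ ?_
  · simp [mul_assoc]
  · simp only [add_assoc, CharTwo.add_self_eq_zero, add_zero]

/-- `sgn` as a permutation. -/
noncomputable def sgnPerm (cs : CoxeterSystem M W) (i : B) : Equiv.Perm (W × ZMod 2) :=
  ⟨sgn cs i, sgn cs i, sgn_invol cs i, sgn_invol cs i⟩

lemma sgn_liftable (cs : CoxeterSystem M W) : M.IsLiftable (sgnPerm cs) := by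
  classical
  intro i j
  ext1 ⟨t, e⟩
  have h : ((sgnPerm cs i * sgnPerm cs j) ^ M i j) (t, e)
      = ((fun p => sgn cs i (sgn cs j p))^[M i j]) (t, e) := by
    rw [Equiv.Perm.coe_pow]; rfl
  rw [h, sgn_pow, cs.simple_mul_simple_pow, two_mul, Finset.sum_range_add]
  simp [pow_add, CharTwo.add_self_eq_zero]

/-- The signed permutation representation. -/
noncomputable def sgnHom (cs : CoxeterSystem M W) : W →* Equiv.Perm (W × ZMod 2) :=
  cs.lift ⟨sgnPerm cs, sgn_liftable cs⟩

open Classical in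
lemma sgnHom_wordProd (cs : CoxeterSystem M W) (l : List B) (t : W) (e : ZMod 2) :
    sgnHom cs (cs.wordProd l) (t, e) =
      (cs.wordProd l * t * (cs.wordProd l)⁻¹, e + ((cs.rightInvSeq l).count t : ZMod 2)) := by
  induction l with
  | nil => simp
  | cons i l ih =>
    rw [cs.wordProd_cons, map_mul, Equiv.Perm.mul_apply, ih, sgnHom, cs.lift_apply_simple]
    have e1 : cs.wordProd l * t * (cs.wordProd l)⁻¹ = cs.simple i ↔
        (cs.wordProd l)⁻¹ * cs.simple i * cs.wordProd l = t := by
      constructor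
      · intro h; rw [← h]; group
      · intro h; rw [← h]; group
    simp only [sgnPerm, Equiv.coe_fn_mk, sgn, e1, CoxeterSystem.rightInvSeq, List.count_cons,
      beq_iff_eq]
    refine Prod.ext ?_ ?_
    · simp [mul_assoc]
    · push_cast
      simp [add_assoc]

lemma exchange (cs : CoxeterSystem M W) (l : List B) (i : B)
    (h : cs.length (cs.wordProd l * cs.simple i) < cs.length (cs.wordProd l)) :
    cs.simple i ∈ cs.rightInvSeq l := by
  classical
  obtain ⟨l', hr, hl'⟩ := cs.exists_isReduced (cs.wordProd l * cs.simple i)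
  have hnot : cs.simple i ∉ cs.rightInvSeq l' := by
    intro hm
    have := (cs.isRightInversion_of_mem_rightInvSeq hr hm).2
    rw [← hl', cs.simple_mul_simple_cancel_right] at this
    omega
  have hw : cs.wordProd l = cs.wordProd (l'.concat i) := by
    rw [cs.wordProd_concat, ← hl', cs.simple_mul_simple_cancel_right]
  have h1 := sgnHom_wordProd cs l (cs.simple i) 0
  have h2 := sgnHom_wordProd cs (l'.concat i) (cs.simple i) 0
  rw [← hw, h1] at h2
  have h3 := (Prod.ext_iff.1 h2).2
  have h4 : ((cs.rightInvSeq (l'.concat i)).count (cs.simple i)) = 1 := by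
    rw [cs.rightInvSeq_concat, List.concat_eq_append, List.count_append]
    have : List.count (cs.simple i)
        (List.map (MulAut.conj (cs.simple i)) (cs.rightInvSeq l')) = 0 := by
      rw [List.count_eq_zero]
      intro hm
      obtain ⟨t, ht, hte⟩ := List.mem_map.1 hm
      apply hnot
      have : t = cs.simple i := by
        rw [MulAut.conj_apply, mul_inv_eq_iff_eq_mul] at hte
        exact mul_left_cancel hte
      rwa [← this]
    rw [this]; simp
  by_contra hc
  rw [h4, List.count_eq_zero.2 hc] at h3
  simp at h3

/-- The simple coroot in the geometric representation. -/
noncomputable def coroot (M : CoxeterMatrix B) (i : B) : Module.Dual ℝ (B →₀ ℝ) :=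
  Finsupp.linearCombination ℝ (fun k => -2 * Real.cos (Real.pi / M i k))

lemma coroot_single (M : CoxeterMatrix B) (i k : B) :
    coroot M i (Finsupp.single k 1) = -2 * Real.cos (Real.pi / M i k) := by
  simp [coroot]

lemma coroot_self (M : CoxeterMatrix B) (i : B) :
    coroot M i (Finsupp.single i 1) = 2 := by
  simp [coroot_single, M.diagonal]

/-- The simple reflection in the geometric representation. -/
noncomputable def geo (M : CoxeterMatrix B) (i : B) : (B →₀ ℝ) ≃ₗ[ℝ] (B →₀ ℝ) :=
  Module.reflection (coroot_self M i)

open Polynomial.Chebyshev in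
lemma geo_liftable (M : CoxeterMatrix B) : M.IsLiftable (geo M) := by
  intro i j
  by_cases hij : i = j
  · subst hij
    rw [M.diagonal, pow_one]
    ext1 z
    exact Module.involutive_reflection (coroot_self M i) z
  have hm1 : M i j ≠ 1 := M.off_diagonal i j hij
  have hsym : M j i = M i j := M.symmetric j i
  ext1 z
  change ((Module.reflection (coroot_self M i) * Module.reflection (coroot_self M j)) ^ M i j) z = z
  rw [Module.reflection_mul_reflection_pow_apply (coroot_self M i) (coroot_self M j) (M i j) z
    (2 * Real.cos (2 * (Real.pi / M i j))) (by
      rw [coroot_single, coroot_single, hsym, Real.cos_two_mul]; ring)]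
  rw [coroot_single, coroot_single, hsym]
  generalize M i j = m at hm1
  rcases Nat.eq_zero_or_pos m with rfl | hpos
  · simp
  by_cases h2 : m = 2
  · subst h2
    have hs : (Polynomial.eval (2 * Real.cos (2 * (Real.pi / (2 : ℕ)))) (S ℝ 1)) = -2 := by
      rw [S_one, Polynomial.eval_X]
      push_cast
      rw [mul_div_cancel₀ _ (two_ne_zero), Real.cos_pi]; norm_num
    have hp : 2 * (Real.pi / 2) = Real.pi := by ring
    norm_num [Real.cos_pi_div_two, hp]
    try module
  have hm3 : 3 ≤ m := by omega
  have hmR : (3 : ℝ) ≤ m := by exact_mod_cast hm3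
  have hθ : (m : ℝ) * (Real.pi / m) = Real.pi := by field_simp
  have hsin : Real.sin (2 * (Real.pi / m)) ≠ 0 := by
    apply ne_of_gt
    apply Real.sin_pos_of_pos_of_lt_pi
    · positivity
    · have : 0 < Real.pi / m := by positivity
      nlinarith
  generalize Real.pi / m = θ at *
  have hS := fun n : ℤ => S_two_mul_real_cos (2 * θ) n
  rcases Nat.even_or_odd' m with ⟨p, rfl | rfl⟩
  · have i1 : (((2 * p : ℕ) : ℤ) - 2) / 2 = p - 1 := by omega
    have i2 : (((2 * p : ℕ) : ℤ) - 1) / 2 = p - 1 := by omega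
    have h0 : Polynomial.eval (2 * Real.cos (2 * θ)) (S ℝ (p - 1)) = 0 := by
      have := hS (p - 1)
      push_cast at this hθ
      rw [show ((p : ℝ) - 1 + 1) * (2 * θ) = Real.pi by linarith, Real.sin_pi] at this
      exact (mul_eq_zero.1 this).resolve_right hsin
    rw [i1, i2, h0]; simp
  · have i1 : (((2 * p + 1 : ℕ) : ℤ) - 2) / 2 = p - 1 := by omega
    have i2 : (((2 * p + 1 : ℕ) : ℤ) - 1) / 2 = p := by omega
    have i3 : (((2 * p + 1 : ℕ) : ℤ) - 3) / 2 = p - 1 := by omega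
    have i4 : (((2 * p + 1 : ℕ) : ℤ)) / 2 = p := by omega
    have h0 : Polynomial.eval (2 * Real.cos (2 * θ)) (S ℝ p)
        + Polynomial.eval (2 * Real.cos (2 * θ)) (S ℝ (p - 1)) = 0 := by
      have a := hS (p - 1)
      have b := hS p
      push_cast at a b hθ
      rw [show ((p : ℝ) - 1 + 1) * (2 * θ) = Real.pi - θ by linarith, Real.sin_pi_sub] at a
      rw [show ((p : ℝ) + 1) * (2 * θ) = θ + Real.pi by linarith, Real.sin_add_pi] at b
      refine (mul_eq_zero.1 (?_ : _ * Real.sin (2 * θ) = 0)).resolve_right hsin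
      linarith
    rw [i1, i2, i3, i4, h0]; simp

/-- The geometric representation. -/
noncomputable def geoHom (cs : CoxeterSystem M W) : W →* ((B →₀ ℝ) ≃ₗ[ℝ] (B →₀ ℝ)) :=
  cs.lift ⟨geo M, geo_liftable M⟩

lemma geoHom_coord (cs : CoxeterSystem M W) (b : B) (l : List B) (hb : b ∉ l) (v : B →₀ ℝ) :
    geoHom cs (cs.wordProd l) v b = v b := by
  induction l with
  | nil => simp
  | cons i l ih =>
    rw [List.mem_cons, not_or] at hb
    rw [cs.wordProd_cons, map_mul, LinearEquiv.mul_apply, geoHom, cs.lift_apply_simple]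
    change Module.reflection (coroot_self M i) (geoHom cs (cs.wordProd l) v) b = v b
    rw [Module.reflection_apply, Finsupp.sub_apply, ih hb.2]
    simp [Finsupp.single_apply, Ne.symm hb.1]

lemma simple_ne_wordProd (cs : CoxeterSystem M W) (b : B) (l : List B) (hb : b ∉ l) :
    cs.simple b ≠ cs.wordProd l := by
  intro h
  have h1 := geoHom_coord cs b l hb (Finsupp.single b 1)
  rw [← h, geoHom, cs.lift_apply_simple] at h1
  change Module.reflection (coroot_self M b) (Finsupp.single b 1) b = _ at h1
  rw [Module.reflection_apply, coroot_self] at h1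
  norm_num at h1

lemma mem_ris (cs : CoxeterSystem M W) (l : List B) (t : W) (h : t ∈ cs.rightInvSeq l) :
    ∃ (a : List B) (b : B) (d : List B), l = a ++ b :: d ∧
      t = (cs.wordProd d)⁻¹ * cs.simple b * cs.wordProd d := by
  induction l with
  | nil => simp at h
  | cons i l ih =>
    rw [CoxeterSystem.rightInvSeq, List.mem_cons] at h
    rcases h with h | h
    · exact ⟨[], i, l, rfl, h⟩
    · obtain ⟨a, b, d, rfl, h'⟩ := ih h
      exact ⟨i :: a, b, d, rfl, h'⟩

lemma std_right (cs : CoxeterSystem M W) (c : W)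
    (hc : IsStdCoxeterElement cs c) (i : B)
    (h : cs.length (c * cs.simple i) < cs.length c) :
    IsStdCoxeterElement cs (cs.simple i * c * cs.simple i) := by
  obtain ⟨l, hn, hall, rfl⟩ := hc
  obtain ⟨a, b, d, rfl, ht⟩ := mem_ris cs l _ (exchange cs l i h)
  have hbd : b ∉ d := fun hb => by
    have := (List.nodup_append.1 hn).2.1
    exact (List.nodup_cons.1 this).1 hb
  have hbi : b = i := by
    by_contra hne
    refine simple_ne_wordProd cs b (d ++ i :: d.reverse) ?_ ?_
    · simp [hbd, hne]
    · rw [cs.wordProd_append, cs.wordProd_cons, cs.wordProd_reverse, ht]; group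
  subst hbi
  have hp : (b :: (a ++ d)).Perm (a ++ b :: d) := List.perm_middle.symm
  refine ⟨b :: (a ++ d), hp.nodup_iff.2 hn, fun k => hp.mem_iff.2 (hall k), ?_⟩
  have h5 : cs.wordProd d * cs.simple b = cs.simple b * cs.wordProd d := by
    nth_rw 1 [ht]; group
  rw [cs.wordProd_cons, cs.wordProd_append, cs.wordProd_append, cs.wordProd_cons]
  simp only [mul_assoc]
  rw [h5, cs.simple_mul_simple_cancel_left]

lemma std_inv (cs : CoxeterSystem M W) (c : W) (hc : IsStdCoxeterElement cs c) :
    IsStdCoxeterElement cs c⁻¹ := by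
  obtain ⟨l, hn, hall, rfl⟩ := hc
  exact ⟨l.reverse, List.nodup_reverse.2 hn, fun k => List.mem_reverse.2 (hall k),
    cs.wordProd_reverse l⟩

/-- Lemma 2.3: if `s` is a left or right descent of a standard Coxeter element `c`,
then `scs` is again a standard Coxeter element. -/
theorem stmt6 [Finite W] (cs : CoxeterSystem M W) (c : W)
    (hc : IsStdCoxeterElement cs c) (i : B)
    (hdesc : cs.length (cs.simple i * c) < cs.length c ∨
      cs.length (c * cs.simple i) < cs.length c) :
    IsStdCoxeterElement cs (cs.simple i * c * cs.simple i) := by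
  rcases hdesc with h | h
  · have h1 := std_inv cs _ (std_right cs c⁻¹ (std_inv cs c hc) i (by
      rw [← cs.length_inv, ← cs.length_inv c⁻¹]; simpa using h))
    simpa [mul_assoc] using h1
  · exact std_right cs c hc i h

end NCpaper
end

section
/- Let (W,S) be a finite Coxeter system with standard Coxeter element c, and let w ∈ NC(W,c) with w ≤ c in absolute order. Let t ∈ T be a reflection with tw < w in absolute order and tc <_B c in Bruhat order. Then tw <_B w in Bruhat order. -/
namespace NCpaper

open CoxeterSystem

variable {B : Type*} {W : Type*} [Group W] {M : CoxeterMatrix B}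

/-! ### The geometric representation -/

section GeomRep

open Module


/-- simple root -/
noncomputable def sr (i : B) : B →₀ ℝ := Finsupp.single i 1

/-- simple coroot -/
noncomputable def sc (M : CoxeterMatrix B) (i : B) : Dual ℝ (B →₀ ℝ) :=
  Finsupp.linearCombination ℝ (fun j => -2 * Real.cos (Real.pi / M i j))

lemma sc_sr (i j : B) : sc M i (sr j) = -2 * Real.cos (Real.pi / M i j) := by
  simp [sc, sr]

lemma sc_self (i : B) : sc M i (sr i) = 2 := by
  rw [sc_sr]; simp

lemma sc_comm (i j : B) : sc M i (sr j) = sc M j (sr i) := by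
  rw [sc_sr, sc_sr, M.symmetric]

/-- simple reflection acting on the root space -/
noncomputable def srefl (M : CoxeterMatrix B) (i : B) : (B →₀ ℝ) ≃ₗ[ℝ] (B →₀ ℝ) :=
  Module.reflection (sc_self (M := M) i)

lemma srefl_apply (i : B) (x : B →₀ ℝ) : srefl M i x = x - sc M i x • sr i :=
  Module.reflection_apply _ _

lemma srefl_liftable : M.IsLiftable (srefl M) := by
  intro i j
  by_cases hij : i = j
  · subst hij
    rw [M.diagonal, pow_one]
    ext1 x
    rw [LinearEquiv.mul_apply, srefl_apply, srefl_apply, map_sub, map_smul, sc_self]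
    simp only [LinearEquiv.coe_one, id, smul_eq_mul]
    module
  have h1 : M i j ≠ 1 := M.off_diagonal i j hij
  rcases Nat.eq_zero_or_pos (M i j) with h0 | hpos
  · rw [h0, pow_zero]
  by_cases h2 : M i j = 2
  · rw [h2, pow_two]
    have e1 : sc M i (sr j) = 0 := by rw [sc_sr, h2]; simp
    have e2 : sc M j (sr i) = 0 := by rw [sc_comm, e1]
    ext1 x
    simp only [LinearEquiv.mul_apply, srefl_apply, map_sub, map_smul, e1, e2, sc_self]
    simp only [LinearEquiv.coe_one, id]
    module
  have hm3 : 3 ≤ M i j := by omega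
  set m := M i j with hm
  have hmR : (3:ℝ) ≤ m := by exact_mod_cast hm3
  set θ : ℝ := 2 * (Real.pi / m) with hθ
  have hmθ : (m:ℝ) * θ = 2 * Real.pi := by rw [hθ]; field_simp
  have hs : Real.sin θ ≠ 0 := by
    apply ne_of_gt
    have hpi := Real.pi_pos
    apply Real.sin_pos_of_pos_of_lt_pi
    · positivity
    · nlinarith
  have ht : 2 * Real.cos θ = sc M i (sr j) * sc M j (sr i) - 2 := by
    rw [sc_comm j i, sc_sr, ← hm, hθ, Real.cos_two_mul]; ring
  have hS (n : ℤ) : (Polynomial.Chebyshev.S ℝ n).eval (2 * Real.cos θ) = Real.sin ((n+1) * θ) / Real.sin θ := by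
    rw [eq_div_iff hs]; exact Polynomial.Chebyshev.S_two_mul_real_cos θ n
  ext1 x
  rw [srefl, srefl, Module.reflection_mul_reflection_pow_apply _ _ m x (2 * Real.cos θ) ht]
  simp only [hS]
  rcases Nat.even_or_odd' m with ⟨k, hk | hk⟩
  · have a1 : ((m:ℤ) - 2)/2 = k - 1 := by omega
    have a2 : ((m:ℤ) - 1)/2 = k - 1 := by omega
    have e : Real.sin (((((k:ℤ) - 1 : ℤ) : ℝ) + 1) * θ) = 0 := by
      have : ((((k:ℤ) - 1 : ℤ) : ℝ) + 1) * θ = Real.pi := by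
        have : (m:ℝ) = 2 * k := by exact_mod_cast hk
        push_cast
        rw [this] at hmθ; linarith
      rw [this, Real.sin_pi]
    rw [a1, a2, e]
    simp
  · have a1 : ((m:ℤ) - 2)/2 = k - 1 := by omega
    have a2 : ((m:ℤ) - 1)/2 = k := by omega
    have a3 : ((m:ℤ) - 3)/2 = k - 1 := by omega
    have a4 : (m:ℤ)/2 = k := by omega
    have e : Real.sin ((((k:ℤ) : ℝ) + 1) * θ) / Real.sin θ + Real.sin (((((k:ℤ) - 1 : ℤ) : ℝ) + 1) * θ) / Real.sin θ = 0 := by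
      have : (((k:ℤ) : ℝ) + 1) * θ = 2 * Real.pi - ((((k:ℤ) - 1 : ℤ) : ℝ) + 1) * θ := by
        have : (m:ℝ) = 2 * k + 1 := by exact_mod_cast hk
        push_cast
        rw [this] at hmθ; linarith
      rw [this, Real.sin_two_pi_sub]; ring
    rw [a1, a2, a3, a4, e]
    simp

/-- The geometric representation. -/
noncomputable def rho (cs : CoxeterSystem M W) : W →* ((B →₀ ℝ) ≃ₗ[ℝ] (B →₀ ℝ)) :=
  cs.lift ⟨srefl M, srefl_liftable⟩

variable (cs : CoxeterSystem M W)

lemma rho_simple (i : B) (x : B →₀ ℝ) : rho cs (cs.simple i) x = x - sc M i x • sr i := by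
  rw [rho, cs.lift_apply_simple, srefl_apply]

lemma rho_simple_self (i : B) : rho cs (cs.simple i) (sr i) = - sr i := by
  rw [rho_simple, sc_self]; module

lemma rho_mul (g h : W) (x : B →₀ ℝ) : rho cs (g * h) x = rho cs g (rho cs h x) := by
  rw [map_mul, LinearEquiv.mul_apply]

lemma rho_one (x : B →₀ ℝ) : rho cs 1 x = x := by
  rw [map_one]; rfl

lemma rho_inv_rho (g : W) (x : B →₀ ℝ) : rho cs g⁻¹ (rho cs g x) = x := by
  rw [← rho_mul, inv_mul_cancel, rho_one]

lemma rho_rho_inv (g : W) (x : B →₀ ℝ) : rho cs g (rho cs g⁻¹ x) = x := by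
  rw [← rho_mul, mul_inv_cancel, rho_one]

/-- The symmetric form (scaled by 2). -/
noncomputable def bf (M : CoxeterMatrix B) : (B →₀ ℝ) →ₗ[ℝ] Dual ℝ (B →₀ ℝ) :=
  Finsupp.linearCombination ℝ (sc M)

lemma bf_sr (i : B) (y : B →₀ ℝ) : bf M (sr i) y = sc M i y := by
  simp [bf, sr]

lemma bf_sr' (x : B →₀ ℝ) (i : B) : bf M x (sr i) = sc M i x := by
  have : (bf M).flip (sr i) = sc M i := by
    apply Finsupp.lhom_ext'
    intro j
    ext
    have := sc_comm (M := M) j i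
    simpa [bf, sr] using this
  rw [← this]; rfl

lemma bf_rho (w : W) : ∀ x y, bf M (rho cs w x) (rho cs w y) = bf M x y := by
  induction w using cs.simple_induction_left with
  | one => intro x y; simp
  | mul_simple_left w i ih =>
    intro x y
    rw [rho_mul, rho_mul, rho_simple, rho_simple]
    simp only [map_sub, map_smul, LinearMap.sub_apply, LinearMap.smul_apply, bf_sr, bf_sr', sc_self,
      smul_eq_mul, ih]
    ring

/-- a reflection acts as a reflection -/
lemma rho_conj (g : W) (i : B) (x : B →₀ ℝ) :
    rho cs (g * cs.simple i * g⁻¹) x = x - sc M i (rho cs g⁻¹ x) • rho cs g (sr i) := by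
  rw [rho_mul, rho_mul, rho_simple, map_sub, map_smul, rho_rho_inv]

lemma sc_rho_inv (g : W) (i : B) (x : B →₀ ℝ) :
    sc M i (rho cs g⁻¹ x) = bf M (rho cs g (sr i)) x := by
  rw [← bf_sr, ← bf_rho cs g, rho_rho_inv]

/-! ### Alternating words -/

/-- Normalized Chebyshev-type sequence. -/
noncomputable def uu (a : ℝ) : ℕ → ℝ
  | 0 => 0
  | 1 => 1
  | (n+2) => a * uu a (n+1) - uu a n

lemma uu_nonneg (m n : ℕ) (h1 : m ≠ 1) (h : m = 0 ∨ n ≤ m) :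
    0 ≤ uu (2 * Real.cos (Real.pi / m)) n := by
  rcases Nat.eq_zero_or_pos m with rfl | hm
  · have : ∀ n : ℕ, uu (2 * Real.cos (Real.pi / (0:ℕ))) n = n ∧
        uu (2 * Real.cos (Real.pi / (0:ℕ))) (n+1) = n + 1 := by
      intro n
      induction n with
      | zero => simp [uu]
      | succ n ih =>
        refine ⟨by rw [ih.2]; push_cast; rfl, ?_⟩
        rw [uu, ih.1, ih.2]; simp; ring
    rw [(this n).1]; positivity
  · have hn : n ≤ m := by omega
    have hm2 : 2 ≤ m := by omega
    have hmR : (2:ℝ) ≤ m := by exact_mod_cast hm2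
    set θ := Real.pi / m with hθ
    have hmθ : (m:ℝ) * θ = Real.pi := by rw [hθ]; field_simp
    have hpi := Real.pi_pos
    have hθ0 : 0 < θ := by positivity
    have hs : 0 < Real.sin θ := by
      apply Real.sin_pos_of_pos_of_lt_pi hθ0
      nlinarith
    have : ∀ n : ℕ, uu (2 * Real.cos θ) n * Real.sin θ = Real.sin (n * θ) ∧
        uu (2 * Real.cos θ) (n+1) * Real.sin θ = Real.sin ((n + 1) * θ) := by
      intro n
      induction n with
      | zero => simp [uu]
      | succ n ih =>
        refine ⟨by rw [ih.2]; push_cast; rfl, ?_⟩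
        rw [uu, sub_mul, ih.1, mul_assoc, ih.2]
        have e1 : ((n+1 : ℕ) + 1 : ℝ) * θ = (n+1) * θ + θ := by push_cast; ring
        have e2 : (n:ℝ) * θ = (n+1) * θ - θ := by ring
        rw [e1, e2, Real.sin_add, Real.sin_sub]; ring
    have h2 : 0 ≤ Real.sin (n * θ) := by
      apply Real.sin_nonneg_of_nonneg_of_le_pi (by positivity)
      rw [← hmθ]
      have : (n:ℝ) ≤ m := by exact_mod_cast hn
      nlinarith
    rw [← (this n).1] at h2
    exact nonneg_of_mul_nonneg_left h2 hs

lemma rho_alt (i j : B) (k : ℕ) :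
    rho cs (cs.wordProd (alternatingWord i j k)) (sr i) =
      uu (2 * Real.cos (Real.pi / M i j)) (k+1) • (sr (if Even k then i else j) : B →₀ ℝ) +
      uu (2 * Real.cos (Real.pi / M i j)) k • sr (if Even k then j else i) := by
  induction k with
  | zero => simp [uu, alternatingWord]
  | succ k ih =>
    rw [alternatingWord_succ', cs.wordProd_cons, rho_mul, ih]
    have e1 := sc_sr (M := M) i j
    have e2 := sc_sr (M := M) j i
    rw [M.symmetric j i] at e2
    by_cases hk : Even k
    · have hk' : ¬ Even (k+1) := by simpa [Nat.even_add_one] using hk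
      simp only [hk, hk', if_true, if_false, rho_simple, map_add, map_smul, sc_self, e2, uu]
      module
    · have hk' : Even (k+1) := by simpa [Nat.even_add_one] using hk
      simp only [hk, hk', if_true, if_false, rho_simple, map_add, map_smul, sc_self, e1, uu]
      module


/-! ### Positivity of roots -/

/-- nonnegative coordinates -/
def Nonneg (x : B →₀ ℝ) : Prop := ∀ k, 0 ≤ x k

lemma nonneg_sr (i : B) : Nonneg (sr i) := by
  intro k
  by_cases h : i = k
  · subst h; simp [sr]
  · simp [sr, h]

lemma Nonneg.comb {x y : B →₀ ℝ} (hx : Nonneg x) (hy : Nonneg y) {a b : ℝ} (ha : 0 ≤ a)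
    (hb : 0 ≤ b) : Nonneg (a • x + b • y) := by
  intro k
  have := hx k
  have := hy k
  simp only [Finsupp.add_apply, Finsupp.smul_apply, smul_eq_mul]
  positivity

lemma nonneg_of_not_descent (n : ℕ) : ∀ (w : W), cs.length w = n → ∀ i,
    ¬ cs.IsRightDescent w i → Nonneg (rho cs w (sr i)) := by
  induction n using Nat.strong_induction_on with
  | _ n ih =>
  intro w hw i hi
  by_cases hw1 : w = 1
  · subst hw1; rw [rho_one]; exact nonneg_sr i
  obtain ⟨j, hj⟩ := cs.exists_rightDescent_of_ne_one hw1
  have hij : i ≠ j := by rintro rfl; exact hi hj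
  let A : ℕ → W := fun k => cs.wordProd (alternatingWord i j k)
  let P : ℕ → Prop := fun k => cs.length (w * (A k)⁻¹) + k = cs.length w
  have hP1 : P 1 := by
    have := cs.isRightDescent_iff.1 hj
    simpa [P, A, alternatingWord] using this
  have hex : ∃ k, 1 ≤ k ∧ P k ∧ ¬ P (k+1) := by
    by_contra hcon
    push Not at hcon
    have : ∀ k, P (k+1) := by
      intro k
      induction k with
      | zero => exact hP1
      | succ k ihk => exact hcon (k+1) (by omega) ihk
    have := this (cs.length w)
    simp only [P] at this
    omega
  obtain ⟨k, hk1, hPk, hPk1⟩ := hex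
  obtain ⟨k, rfl⟩ : ∃ k', k = k' + 1 := ⟨k-1, by omega⟩
  set v := w * (A (k+1))⁻¹ with hv
  have hwv : w = v * A (k+1) := by rw [hv]; group
  have hPk' : cs.length v + (k+1) = cs.length w := hPk
  set x := if Even k then j else i with hx
  set y := if Even (k+1) then j else i with hy
  have hA1 : A (k+1) = cs.simple x * A k := by
    simp only [A]; rw [alternatingWord_succ', cs.wordProd_cons]
  have hA2 : A (k+2) = cs.simple y * A (k+1) := by
    simp only [A]; rw [alternatingWord_succ' i j (k+1), cs.wordProd_cons]
  have hAlen : ∀ k, cs.length (A k) ≤ k := by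
    intro k
    have := cs.length_wordProd_le (alternatingWord i j k)
    simpa [A] using this
  have hvx : ¬ cs.IsRightDescent v x := by
    intro h
    have h1 := cs.isRightDescent_iff.1 h
    have h2 : w = (v * cs.simple x) * A k := by rw [mul_assoc, ← hA1]; exact hwv
    have h3 := cs.length_mul_le (v * cs.simple x) (A k)
    rw [← h2] at h3
    have := hAlen k
    omega
  have hvy : ¬ cs.IsRightDescent v y := by
    intro h
    have h1 := cs.isRightDescent_iff.1 h
    apply hPk1
    show cs.length (w * (A (k+2))⁻¹) + (k+2) = cs.length w
    have h2 : w * (A (k+2))⁻¹ = v * cs.simple y := by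
      rw [hA2, mul_inv_rev, cs.inv_simple, ← mul_assoc, hv]
    rw [h2]; omega
  have hxp := ih (cs.length v) (by omega) v rfl x hvx
  have hyp := ih (cs.length v) (by omega) v rfl y hvy
  have hM : M i j = 0 ∨ k + 2 ≤ M i j := by
    by_contra hcon
    push Not at hcon
    obtain ⟨hM0, hMk⟩ := hcon
    have hlen : cs.length (A (k+1)) = k+1 := by
      have h3 := cs.length_mul_le v (A (k+1))
      rw [← hwv] at h3
      have := hAlen (k+1)
      omega
    by_cases hlt : M i j < k+1
    · apply cs.not_isReduced_alternatingWord i j hM0 hlt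
      show cs.length (A (k+1)) = _
      rw [hlen, length_alternatingWord]
    · have heq : M i j = k+1 := by omega
      have hb := cs.wordProd_braidWord_eq i j
      have h4 : A (k+1) = A k * cs.simple i := by
        have e1 : A (k+1) = cs.wordProd (braidWord M i j) := by
          simp only [A, braidWord, heq]
        rw [e1, hb, braidWord, M.symmetric j i, heq, alternatingWord_succ, cs.wordProd_concat]
      apply hi
      have h5 : w * cs.simple i = v * A k := by
        rw [hwv, h4]; simp [mul_assoc]
      show cs.length (w * cs.simple i) < cs.length w
      rw [h5]
      have := cs.length_mul_le v (A k)
      have := hAlen k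
      omega
  have hM1 : M i j ≠ 1 := M.off_diagonal i j hij
  have hexp : rho cs w (sr i) = uu (2 * Real.cos (Real.pi / M i j)) (k+2) • rho cs v (sr x) +
      uu (2 * Real.cos (Real.pi / M i j)) (k+1) • rho cs v (sr y) := by
    rw [hwv, rho_mul]
    simp only [A]
    rw [rho_alt, map_add, map_smul, map_smul]
    have : (if Even (k+1) then i else j) = x := by
      rw [hx]
      by_cases h : Even k
      · have hk' : ¬ Even (k+1) := by simpa [Nat.even_add_one] using h
        simp [h, hk']
      · have hk' : Even (k+1) := by simpa [Nat.even_add_one] using h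
        simp [h, hk']
    rw [this]
  rw [hexp]
  exact hxp.comb hyp (uu_nonneg _ _ hM1 (by omega)) (uu_nonneg _ _ hM1 (by omega))

lemma nonneg_neg_of_descent (w : W) (i : B) (h : cs.IsRightDescent w i) :
    Nonneg (- rho cs w (sr i)) := by
  have h1 := nonneg_of_not_descent cs _ (w * cs.simple i) rfl i
    (cs.isRightDescent_iff_not_isRightDescent_mul.1 h)
  rwa [rho_mul, rho_simple_self, map_neg] at h1

lemma root_dichotomy (w : W) (i : B) :
    Nonneg (rho cs w (sr i)) ∨ Nonneg (- rho cs w (sr i)) := by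
  by_cases h : cs.IsRightDescent w i
  · exact Or.inr (nonneg_neg_of_descent cs w i h)
  · exact Or.inl (nonneg_of_not_descent cs _ w rfl i h)

/-- The geometric representation is faithful. -/
lemma rho_faithful (w : W) (h : ∀ x, rho cs w x = x) : w = 1 := by
  by_contra hw
  obtain ⟨i, hi⟩ := cs.exists_rightDescent_of_ne_one hw
  have h1 := nonneg_neg_of_descent cs w i hi i
  rw [h] at h1
  simp [sr] at h1
  linarith

/-- A root which becomes negative after a simple reflection is simple. -/
lemma eq_simple_of_flip (g : W) (i j : B) (h1 : Nonneg (rho cs g (sr i)))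
    (h2 : ¬ Nonneg (rho cs (cs.simple j * g) (sr i))) :
    rho cs g (sr i) = sr j := by
  have h3 := (root_dichotomy cs (cs.simple j * g) i).resolve_left h2
  set β := rho cs g (sr i) with hβ
  rw [rho_mul, ← hβ, rho_simple] at h3
  have h4 : ∀ k, k ≠ j → β k = 0 := by
    intro k hk
    have a := h1 k
    have b := h3 k
    simp [sr, hk.symm] at b
    linarith
  have h5 : β = β j • sr j := by
    ext k
    by_cases hk : k = j
    · subst hk; simp [sr]
    · rw [h4 k hk]; simp [sr, Ne.symm hk]
  have h6 : bf M β β = 2 := by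
    rw [hβ, bf_rho, bf_sr, sc_self]
  rw [h5] at h6
  simp only [map_smul, LinearMap.smul_apply, bf_sr, sc_self, smul_eq_mul] at h6
  have h7 := h1 j
  have h8 : β j = 1 := by nlinarith
  rw [h5, h8, one_smul]

lemma conj_eq_simple (g : W) (i j : B) (h : rho cs g (sr i) = sr j) :
    g * cs.simple i * g⁻¹ = cs.simple j := by
  have : g * cs.simple i * g⁻¹ * cs.simple j = 1 := by
    apply rho_faithful cs
    intro x
    rw [rho_mul, rho_conj, sc_rho_inv, h, bf_sr, ← rho_simple cs, ← rho_mul,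
      cs.simple_mul_simple_self, rho_one]
  rw [← cs.inv_simple j]
  exact eq_inv_of_mul_eq_one_left this

/-- If a positive root is made negative by the inverse of a word, then the reflection occurs in
the left inversion sequence. -/
lemma exists_split (l : List B) : ∀ (g : W) (i : B), Nonneg (rho cs g (sr i)) →
    ¬ Nonneg (rho cs ((cs.wordProd l)⁻¹ * g) (sr i)) →
    ∃ l1 j l2, l = l1 ++ j :: l2 ∧
      g * cs.simple i * g⁻¹ = cs.wordProd l1 * cs.simple j * (cs.wordProd l1)⁻¹ := by
  induction l with
  | nil => intro g i h1 h2; simp at h2; exact absurd h1 h2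
  | cons j l ih =>
    intro g i h1 h2
    by_cases h : Nonneg (rho cs (cs.simple j * g) (sr i))
    · obtain ⟨l1, k, l2, hl, he⟩ := ih (cs.simple j * g) i h (by
        rw [cs.wordProd_cons, mul_inv_rev, cs.inv_simple, mul_assoc] at h2
        exact h2)
      refine ⟨j :: l1, k, l2, by rw [hl]; rfl, ?_⟩
      rw [cs.wordProd_cons]
      calc g * cs.simple i * g⁻¹ = cs.simple j * (cs.simple j * g * cs.simple i * (cs.simple j * g)⁻¹) * (cs.simple j)⁻¹ := by
            simp [mul_assoc]
        _ = _ := by rw [he]; group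
    · refine ⟨[], j, l, rfl, ?_⟩
      rw [conj_eq_simple cs g i j (eq_simple_of_flip cs g i j h1 h)]
      simp

lemma length_lt_of_neg (w g : W) (i : B) (h1 : Nonneg (rho cs g (sr i)))
    (h2 : ¬ Nonneg (rho cs (w⁻¹ * g) (sr i))) :
    cs.length (g * cs.simple i * g⁻¹ * w) < cs.length w := by
  obtain ⟨l, hl, rfl⟩ := cs.exists_isReduced w
  obtain ⟨l1, j, l2, rfl, he⟩ := exists_split cs l g i h1 h2
  rw [he]
  have : cs.wordProd l1 * cs.simple j * (cs.wordProd l1)⁻¹ * cs.wordProd (l1 ++ j :: l2)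
      = cs.wordProd (l1 ++ l2) := by
    rw [cs.wordProd_append, cs.wordProd_append, cs.wordProd_cons]
    simp [mul_assoc]
  rw [this, hl.eq]
  have := cs.length_wordProd_le (l1 ++ l2)
  simp at this ⊢
  omega

lemma nonneg_antisymm (g : W) (i : B) (h1 : Nonneg (rho cs g (sr i)))
    (h2 : Nonneg (- rho cs g (sr i))) : False := by
  have : rho cs g (sr i) = 0 := by
    ext k
    have a := h1 k
    have b := h2 k
    simp at b ⊢
    linarith
  have h3 : (sr i : B →₀ ℝ) = 0 := by
    rw [← rho_inv_rho cs g (sr i), this, map_zero]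
  simp [sr] at h3

/-- Strong exchange. -/
lemma strong_exchange (l : List B) (t : W) (ht : cs.IsReflection t)
    (h : cs.length (t * cs.wordProd l) < cs.length (cs.wordProd l)) :
    ∃ l1 j l2, l = l1 ++ j :: l2 ∧ t = cs.wordProd l1 * cs.simple j * (cs.wordProd l1)⁻¹ := by
  obtain ⟨g, i, hg⟩ : ∃ g i, t = g * cs.simple i * g⁻¹ ∧ Nonneg (rho cs g (sr i)) := by
    obtain ⟨g, i, rfl⟩ := ht
    rcases root_dichotomy cs g i with h | h
    · exact ⟨g, i, rfl, h⟩
    · refine ⟨g * cs.simple i, i, by simp [mul_assoc], ?_⟩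
      rw [rho_mul, rho_simple_self, map_neg]; exact h
  obtain ⟨rfl, hpos⟩ := hg
  by_cases hn : Nonneg (rho cs ((cs.wordProd l)⁻¹ * g) (sr i))
  · exfalso
    set w := cs.wordProd l
    have h1 := length_lt_of_neg cs (g * cs.simple i * g⁻¹ * w) g i hpos (by
      have e : (g * cs.simple i * g⁻¹ * w)⁻¹ * g = w⁻¹ * g * cs.simple i := by
        simp [mul_assoc]
      rw [e, rho_mul, rho_simple_self, map_neg]
      intro hh
      exact nonneg_antisymm cs _ i hn hh)
    have e : g * cs.simple i * g⁻¹ * (g * cs.simple i * g⁻¹ * w) = w := by simp [mul_assoc]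
    rw [e] at h1
    omega
  · exact exists_split cs l g i hpos hn


/-! ### Linear algebra -/

/-- Averaging: for finite `W` the form is nondegenerate. -/
lemma eq_zero_of_sc_eq_zero [Finite W] (cs : CoxeterSystem M W) (x : B →₀ ℝ) (hx : ∀ i, sc M i x = 0) : x = 0 := by
  classical
  have := Fintype.ofFinite W
  have hfix : ∀ w, rho cs w x = x := by
    intro w
    induction w using cs.simple_induction_left with
    | one => exact rho_one cs x
    | mul_simple_left w i ih => rw [rho_mul, ih, rho_simple, hx]; simp
  ext k
  let F : (B →₀ ℝ) →ₗ[ℝ] ℝ := ∑ w : W, (Finsupp.lapply k) ∘ₗ (rho cs w).toLinearMap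
  have hF : ∀ y, F y = ∑ w : W, (rho cs w y) k := by
    intro y; simp [F, LinearMap.sum_apply]
  have hF0 : F = 0 := by
    apply Finsupp.lhom_ext'
    intro i
    ext
    have h1 : F (sr i) = - F (sr i) := by
      calc F (sr i) = ∑ w : W, (rho cs (w * cs.simple i) (sr i)) k := by
            rw [hF]; exact (Equiv.sum_comp (Equiv.mulRight (cs.simple i)) (fun w => (rho cs w (sr i)) k)).symm
        _ = _ := by
            rw [hF, ← Finset.sum_neg_distrib]
            apply Finset.sum_congr rfl
            intro w _
            rw [rho_mul, rho_simple_self, map_neg]; rfl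
    have h2 : F (sr i) = 0 := by linarith
    simpa [sr] using h2
  have h3 := hF x
  rw [hF0] at h3
  simp only [hfix, LinearMap.zero_apply, Finset.sum_const, Finset.card_univ, nsmul_eq_mul] at h3
  have h4 : (Fintype.card W : ℝ) ≠ 0 := by
    have : Nonempty W := ⟨1⟩
    exact_mod_cast Fintype.card_ne_zero
  simpa [h4] using h3.symm

lemma li_cons {ι E : Type*} [AddCommGroup E] [Module ℝ E] (b : ι → E) (p : ι) (L : List ι)
    (h : LinearIndependent ℝ (fun k : Fin (p :: L).length => b ((p :: L).get k))) :
    LinearIndependent ℝ (fun k : Fin L.length => b (L.get k)) ∧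
      b p ∉ Submodule.span ℝ (Set.range (fun k : Fin L.length => b (L.get k))) := by
  rw [← linearIndependent_finCons]
  have e : (Fin.cons (b p) (fun k : Fin L.length => b (L.get k)) : Fin (L.length + 1) → E) =
      (fun k : Fin (p :: L).length => b ((p :: L).get k)) := by
    funext k
    refine Fin.cases ?_ (fun k => ?_) k <;> rfl
  rw [e]
  exact h

lemma carter_span {ι E : Type*} [AddCommGroup E] [Module ℝ E] (b : ι → E) (f : ι → Dual ℝ E)
    (N : Submodule ℝ E) (x : E) (L : List ι) (hN : ∀ p ∈ L, b p ∈ N) :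
    x - (L.map (fun p => preReflection (b p) (f p))).prod x ∈ N := by
  induction L with
  | nil => simp
  | cons p L ih =>
    have h1 := ih (fun q hq => hN q (List.mem_cons_of_mem _ hq))
    rw [List.map_cons, List.prod_cons, Module.End.mul_apply, preReflection_apply]
    have h2 := N.smul_mem (f p ((L.map (fun p => preReflection (b p) (f p))).prod x))
      (hN p List.mem_cons_self)
    have h3 := N.add_mem h1 h2
    convert h3 using 1
    abel

/-- Carter's lemma. -/
lemma carter {ι E : Type*} [AddCommGroup E] [Module ℝ E] (b : ι → E) (f : ι → Dual ℝ E)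
    (h2 : ∀ p, f p (b p) = 2) (x : E) (L : List ι)
    (hli : LinearIndependent ℝ (fun k : Fin L.length => b (L.get k)))
    (hx : (L.map (fun p => preReflection (b p) (f p))).prod x = x) : ∀ p ∈ L, f p x = 0 := by
  induction L with
  | nil => simp
  | cons p L ih =>
    obtain ⟨h3, h4⟩ := li_cons b p L hli
    rw [List.map_cons, List.prod_cons, Module.End.mul_apply] at hx
    set N := Submodule.span ℝ (Set.range (fun k : Fin L.length => b (L.get k)))
    have hs := carter_span b f N x L (fun q hq => by
      obtain ⟨k, rfl⟩ := List.mem_iff_get.1 hq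
      exact Submodule.subset_span ⟨k, rfl⟩)
    set y := (L.map (fun p => preReflection (b p) (f p))).prod x
    have hy : y = x - f p x • b p := by
      rw [← preReflection_apply, ← hx, involutive_preReflection (h2 p) y]
    have h5 : f p x = 0 := by
      by_contra hne
      apply h4
      rw [hy, sub_sub_cancel] at hs
      exact (N.smul_mem_iff hne).1 hs
    rw [h5, zero_smul, sub_zero] at hy
    intro q hq
    rcases List.mem_cons.1 hq with rfl | hq
    · exact h5
    · exact ih h3 hy q hq

/-- A Coxeter element has no nonzero fixed vectors. -/
lemma coxeter_fix [Finite W] (l : List B) (hl : l.Nodup) (hall : ∀ i, i ∈ l) (x : B →₀ ℝ)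
    (hx : rho cs (cs.wordProd l) x = x) : x = 0 := by
  apply eq_zero_of_sc_eq_zero cs
  have key : ∀ l : List B, (l.map (fun p => preReflection (sr p) (sc M p))).prod x
      = rho cs (cs.wordProd l) x := by
    intro l
    induction l with
    | nil => simp
    | cons i l ih =>
      rw [List.map_cons, List.prod_cons, Module.End.mul_apply, ih, cs.wordProd_cons, rho_mul,
        rho_simple, preReflection_apply]
  intro i
  refine carter (fun p => (sr p : B →₀ ℝ)) (fun p => sc M p) (fun p => sc_self p) x l ?_ ?_ i (hall i)
  · have h1 : LinearIndependent ℝ (fun i : B => (sr i : B →₀ ℝ)) := by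
      have := (Finsupp.basisSingleOne (R := ℝ) (ι := B)).linearIndependent
      simpa [sr] using this
    exact h1.comp l.get (List.nodup_iff_injective_get.1 hl)
  · rw [key, hx]

/-- The reflection attached to a pair. -/
def rf (cs : CoxeterSystem M W) (p : W × B) : W := p.1 * cs.simple p.2 * p.1⁻¹

/-- root of a pair -/
noncomputable def rt (cs : CoxeterSystem M W) (p : W × B) : B →₀ ℝ := rho cs p.1 (sr p.2)

/-- coroot of a pair -/
noncomputable def crt (cs : CoxeterSystem M W) (p : W × B) : Dual ℝ (B →₀ ℝ) :=
  sc M p.2 ∘ₗ (rho cs p.1⁻¹).toLinearMap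

lemma rho_rf (p : W × B) (x : B →₀ ℝ) : rho cs (rf cs p) x = x - crt cs p x • rt cs p :=
  rho_conj cs _ _ _

lemma crt_rt (p : W × B) : crt cs p (rt cs p) = 2 := by
  show sc M p.2 (rho cs p.1⁻¹ (rho cs p.1 (sr p.2))) = 2
  rw [rho_inv_rho, sc_self]

lemma dual_prod (ω : Dual ℝ (B →₀ ℝ)) (L : List (W × B)) : ∀ x,
    (L.map (fun p => preReflection (crt cs p) (Dual.eval ℝ _ (rt cs p)))).prod ω x
      = ω (rho cs (L.map (rf cs)).prod⁻¹ x) := by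
  induction L with
  | nil => intro x; simp
  | cons p L ih =>
    intro x
    have e : (rf cs p)⁻¹ = rf cs p := by simp [rf, mul_assoc]
    rw [List.map_cons, List.prod_cons, Module.End.mul_apply, preReflection_apply, List.map_cons,
      List.prod_cons, mul_inv_rev, rho_mul, e, rho_rf, LinearMap.sub_apply, LinearMap.smul_apply,
      Dual.eval_apply, ih, ih, map_sub, map_smul, map_sub, map_smul, smul_eq_mul, smul_eq_mul]
    ring

lemma fix_of_crt (x : B →₀ ℝ) (L : List (W × B)) (h : ∀ p ∈ L, crt cs p x = 0) :
    rho cs (L.map (rf cs)).prod x = x := by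
  induction L with
  | nil => simp
  | cons p L ih =>
    rw [List.map_cons, List.prod_cons, rho_mul, ih (fun q hq => h q (List.mem_cons_of_mem _ hq)),
      rho_rf, h p List.mem_cons_self, zero_smul, sub_zero]

lemma fix_of_rt (ω : Dual ℝ (B →₀ ℝ)) (L : List (W × B)) (h : ∀ p ∈ L, ω (rt cs p) = 0) :
    ∀ x, ω (rho cs (L.map (rf cs)).prod x) = ω x := by
  induction L with
  | nil => intro x; simp
  | cons p L ih =>
    intro x
    rw [List.map_cons, List.prod_cons, rho_mul, rho_rf, map_sub, map_smul,
      ih (fun q hq => h q (List.mem_cons_of_mem _ hq)), h p List.mem_cons_self, smul_zero, sub_zero]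

lemma exists_pairs (R : List W) (h : ∀ t ∈ R, cs.IsReflection t) :
    ∃ L : List (W × B), L.map (rf cs) = R := by
  induction R with
  | nil => exact ⟨[], rfl⟩
  | cons t R ih =>
    obtain ⟨L, hL⟩ := ih (fun q hq => h q (List.mem_cons_of_mem _ hq))
    obtain ⟨g, i, hg⟩ := h t List.mem_cons_self
    exact ⟨(g, i) :: L, by rw [List.map_cons, hL, hg]; rfl⟩

lemma coord_fix (i : B) (l : List B) (h : i ∉ l) (x : B →₀ ℝ) :
    (rho cs (cs.wordProd l) x) i = x i := by
  induction l with
  | nil => simp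
  | cons j l ih =>
    rw [List.mem_cons, not_or] at h
    rw [cs.wordProd_cons, rho_mul, rho_simple, Finsupp.sub_apply, ih h.2, Finsupp.smul_apply, sr,
      Finsupp.single_eq_of_ne h.1, smul_zero, sub_zero]

lemma exists_abs (w : W) : ∃ L : List (W × B), L.length = absLength cs w ∧
    (L.map (rf cs)).prod = w := by
  have hne : {k | ∃ l : List W, (∀ t ∈ l, cs.IsReflection t) ∧ l.length = k ∧ l.prod = w}.Nonempty := by
    obtain ⟨l, _, hl⟩ := cs.exists_isReduced w
    refine ⟨_, l.map cs.simple, ?_, rfl, ?_⟩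
    · intro t ht
      obtain ⟨i, _, rfl⟩ := List.mem_map.1 ht
      exact cs.isReflection_simple i
    · rw [hl]; rfl
  obtain ⟨R, hR, hlen, hprod⟩ := Nat.sInf_mem hne
  obtain ⟨L, rfl⟩ := exists_pairs cs R hR
  exact ⟨L, by rw [List.length_map] at hlen; exact hlen, hprod⟩

lemma abs_wordProd_le (l : List B) : absLength cs (cs.wordProd l) ≤ l.length := by
  apply Nat.sInf_le
  refine ⟨l.map cs.simple, ?_, by simp, rfl⟩
  intro t ht
  obtain ⟨i, _, rfl⟩ := List.mem_map.1 ht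
  exact cs.isReflection_simple i

/-- The main argument. -/
lemma main_length [Finite W] (c : W) (hc : IsStdCoxeterElement cs c) (w t : W)
    (hw : AbsLe cs w c) (ht : cs.IsReflection t) (htw : AbsLe cs (t * w) w)
    (hlt : cs.length (t * c) < cs.length c) : cs.length (t * w) < cs.length w := by
  obtain ⟨l, hnd, hall, rfl⟩ := hc
  obtain ⟨l1, i, l2, hl, htg⟩ := strong_exchange cs l t ht hlt
  set g := cs.wordProd l1 with hg
  have hnd' := hnd
  rw [hl, List.nodup_middle, List.nodup_cons, List.mem_append, not_or] at hnd'
  obtain ⟨⟨hi1, hi2⟩, -⟩ := hnd'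
  have hfin : Finite B := (List.finite_toSet l).subset (fun i _ => hall i) |> Set.finite_univ_iff.1
  have hcard : l.length = Nat.card B := by
    classical
    have := Fintype.ofFinite B
    rw [Nat.card_eq_fintype_card, ← List.toFinset_card_of_nodup hnd]
    rw [← Finset.card_univ]
    congr 1
    ext i; simp [hall i]
  -- factorizations
  obtain ⟨L1, hL1, hP1⟩ := exists_abs cs (t * w)
  obtain ⟨L2, hL2, hP2⟩ := exists_abs cs (w⁻¹ * cs.wordProd l)
  have hpos : 1 ≤ absLength cs ((t * w)⁻¹ * w) := by
    by_contra h0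
    obtain ⟨L3, hL3, hP3⟩ := exists_abs cs ((t * w)⁻¹ * w)
    have : L3 = [] := List.length_eq_zero_iff.1 (by omega)
    subst this
    simp only [List.map_nil, List.prod_nil] at hP3
    have h5 : t * w = w := by rw [← mul_one (t * w), hP3]; group
    have h6 : t = 1 := by simpa using h5
    have := ht.odd_length
    rw [h6, cs.length_one] at this
    simp at this
  have hlen : (L1 ++ L2).length + 1 ≤ Nat.card B := by
    have := abs_wordProd_le cs l
    unfold AbsLe at hw htw
    rw [List.length_append]
    omega
  have hprod : ((L1 ++ L2).map (rf cs)).prod = t * cs.wordProd l := by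
    rw [List.map_append, List.prod_append, hP1, hP2]; group
  -- independence of the coroots
  have htp : t = rf cs (g, i) := htg
  have hprod' : (((g, i) :: (L1 ++ L2)).map (rf cs)).prod = cs.wordProd l := by
    rw [List.map_cons, List.prod_cons, hprod, ← htp, ← mul_assoc, ht.mul_self, one_mul]
  have hspan : ⊤ ≤ Submodule.span ℝ (Set.range
      (fun k : Fin ((g, i) :: (L1 ++ L2)).length => crt cs (((g, i) :: (L1 ++ L2)).get k))) := by
    intro K _
    apply mem_span_of_iInf_ker_le_ker
    intro x hx
    have hx0 : x = 0 := by
      apply coxeter_fix cs l hnd hall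
      rw [← hprod']
      apply fix_of_crt
      intro p hp
      obtain ⟨k, rfl⟩ := List.mem_iff_get.1 hp
      exact (Submodule.mem_iInf _).1 hx k
    rw [hx0]; exact Submodule.zero_mem _
  have hrank : finrank ℝ (Dual ℝ (B →₀ ℝ)) = Nat.card B := by
    rw [Subspace.dual_finrank_eq]
    have := Fintype.ofFinite B
    rw [Module.finrank_finsupp_self, Nat.card_eq_fintype_card]
  have hli : LinearIndependent ℝ
      (fun k : Fin ((g, i) :: (L1 ++ L2)).length => crt cs (((g, i) :: (L1 ++ L2)).get k)) := by
    apply linearIndependent_of_top_le_span_of_card_eq_finrank hspan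
    have h1 := finrank_range_le_card (R := ℝ)
      (fun k : Fin ((g, i) :: (L1 ++ L2)).length => crt cs (((g, i) :: (L1 ++ L2)).get k))
    rw [Set.finrank, top_le_iff.1 hspan, finrank_top, hrank] at h1
    rw [hrank]
    rw [Fintype.card_fin, List.length_cons] at *
    omega
  -- the fundamental weight is fixed
  let ω : Dual ℝ (B →₀ ℝ) := Finsupp.lapply i
  have htc : t * cs.wordProd l = cs.wordProd (l1 ++ l2) := by
    rw [htg, hl, cs.wordProd_append, cs.wordProd_append, cs.wordProd_cons, ← hg]
    simp [mul_assoc]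
  have hωtc : ∀ x, ω (rho cs (t * cs.wordProd l)⁻¹ x) = ω x := by
    intro x
    have h1 := coord_fix cs i (l1 ++ l2) (by simp [hi1, hi2]) (rho cs (t * cs.wordProd l)⁻¹ x)
    rw [← htc, rho_rho_inv] at h1
    exact h1.symm
  have hzero := carter (crt cs) (fun p => Dual.eval ℝ _ (rt cs p)) (fun p => crt_rt cs p) ω (L1 ++ L2)
    (li_cons _ _ _ hli).1 (by
      apply LinearMap.ext
      intro x
      rw [dual_prod, hprod, hωtc])
  have hω : ∀ x, ω (rho cs (t * w) x) = ω x := by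
    intro x
    rw [← hP1]
    exact fix_of_rt cs ω L1 (fun p hp => hzero p (List.mem_append_left _ hp)) x
  have hβ : ω (rho cs g (sr i)) = 1 := by
    have := coord_fix cs i l1 hi1 (sr i)
    rw [sr, Finsupp.single_eq_same] at this
    exact this
  rw [htg]
  apply length_lt_of_neg
  · rcases root_dichotomy cs g i with h | h
    · exact h
    · have h1 := h i
      rw [Finsupp.neg_apply] at h1
      change 0 ≤ - ω (rho cs g (sr i)) at h1
      rw [hβ] at h1
      norm_num at h1
  · intro h
    have h1 := h i
    change 0 ≤ ω _ at h1
    have e : w⁻¹ * g = (t * w)⁻¹ * (g * cs.simple i) := by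
      rw [htg]; simp [mul_assoc]
    rw [← hω, e, ← rho_mul, mul_inv_cancel_left, rho_mul, rho_simple_self, map_neg, map_neg, hβ] at h1
    norm_num at h1

lemma bruhatLt_length {v w : W} (h : BruhatLt cs v w) : cs.length v < cs.length w := by
  induction h with
  | single h => exact h.2
  | tail _ h ih => exact ih.trans h.2

end GeomRep

/-- Lemma 3.4: if `w ≤ c`, `t` is a reflection with `tw < w` in absolute order and
`tc <_B c`, then `tw <_B w`. -/
theorem stmt7 [Finite W] (cs : CoxeterSystem M W) (c : W)
    (hc : IsStdCoxeterElement cs c) (w t : W)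
    (hw : AbsLe cs w c) (ht : cs.IsReflection t)
    (htw : AbsLe cs (t * w) w) (hne : t * w ≠ w)
    (htc : BruhatLt cs (t * c) c) :
    BruhatLt cs (t * w) w := by
  refine Relation.TransGen.single ⟨?_, main_length cs c hc w t hw ht htw (bruhatLt_length cs htc)⟩
  have e : (t * w)⁻¹ * w = w⁻¹ * t * (w⁻¹)⁻¹ := by
    rw [mul_inv_rev, ht.inv, inv_inv]
  rw [e]
  exact ht.conj w⁻¹

end NCpaper
end
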